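/- arXiv:2604.12883 — 6 statements merged into one kernel-verified Lean document; each statement's English description precedes it below -/
import Mathlib

section
/- Let p be a nonzero univariate real polynomial of degree m ≥ 1. Let S be a finite set of ordered pairs (a, b) of real numbers with a < b such that: (i) for each (a, b) ∈ S, the evaluation map of p restricted to the open interval (a, b) is a bijection onto the open interval (−1, 1); and (ii) the open intervals (a, b) corresponding to distinct elements of S are pairwise disjoint. Then the cardinality of S is at most m. -/
open Set Polynomial

/-- A nonzero real polynomial of degree `m ≥ 1` has at most `m` pairwise disjoint
full branch intervals, i.e. open intervals mapped bijectively onto `(−1, 1)`. -/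
theorem branch_count_le_degree (p : Polynomial ℝ) (m : ℕ) (hp : p ≠ 0)
    (hdeg : p.natDegree = m) (hm : 1 ≤ m) (S : Finset (ℝ × ℝ))
    (hlt : ∀ s ∈ S, s.1 < s.2)
    (hbij : ∀ s ∈ S, Set.BijOn (fun x => p.eval x) (Set.Ioo s.1 s.2) (Set.Ioo (-1 : ℝ) 1))
    (hdisj : ∀ s ∈ S, ∀ s' ∈ S, s ≠ s' →
      Disjoint (Set.Ioo s.1 s.2) (Set.Ioo s'.1 s'.2)) :
    S.card ≤ m := by
  classical
  have hroot : ∀ s ∈ S, ∃ x ∈ Set.Ioo s.1 s.2, p.eval x = 0 := fun s hs =>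
    (hbij s hs).surjOn ⟨by norm_num, by norm_num⟩
  choose! f hf hf0 using hroot
  calc S.card ≤ p.roots.toFinset.card := by
        refine Finset.card_le_card_of_injOn f (fun s hs => ?_) (fun s hs t ht hst => ?_)
        · simpa [hp] using hf0 s hs
        · by_contra hne
          exact Set.disjoint_left.mp (hdisj s hs t ht hne) (hf s hs) (hst ▸ hf t ht)
    _ ≤ p.roots.card := p.roots.toFinset_card_le
    _ ≤ m := hdeg ▸ p.card_roots'
end

section
/- Let P ∈ MvPolynomial (Fin 2) ℝ have total degree at most d, and let p be a univariate real polynomial with p.natDegree ≤ m, where m ≥ 1. Then the bivariate polynomial p'(v) · P(p(u), p(v)) — the product of p' applied to the second variable with the polynomial obtained from P by substituting p applied to the first variable for the first variable and p applied to the second variable for the second variable — has total degree at most m·d + (m − 1). -/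
open MvPolynomial

theorem MvPolynomial.totalDegree_polynomialAeval_X_le {σ R : Type*} [CommSemiring R] (i : σ)
    (p : Polynomial R) :
    (Polynomial.aeval (X i : MvPolynomial σ R) p).totalDegree ≤ p.natDegree := by
  rw [Polynomial.aeval_eq_sum_range]
  refine totalDegree_finsetSum_le fun k hk ↦ (totalDegree_smul_le _ _).trans ?_
  rw [X_pow_eq_monomial]
  refine (totalDegree_monomial_le _ _).trans ?_
  simpa using Nat.lt_succ_iff.mp (Finset.mem_range.mp hk)

theorem MvPolynomial.totalDegree_bind₁_le {σ τ R : Type*} [CommSemiring R]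
    (f : σ → MvPolynomial τ R) {m : ℕ} (hf : ∀ i, (f i).totalDegree ≤ m) (P : MvPolynomial σ R) :
    (bind₁ f P).totalDegree ≤ m * P.totalDegree := by
  rw [← aeval_eq_bind₁, aeval_def, eval₂_eq]
  refine totalDegree_finsetSum_le fun s hs ↦ (totalDegree_mul _ _).trans ?_
  rw [algebraMap_eq, totalDegree_C, zero_add]
  calc (∏ i ∈ s.support, f i ^ s i).totalDegree
      ≤ ∑ i ∈ s.support, (f i ^ s i).totalDegree := totalDegree_finsetProd _ _
    _ ≤ ∑ i ∈ s.support, m * s i := Finset.sum_le_sum fun i _ ↦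
        (totalDegree_pow _ _).trans (by rw [mul_comm]; gcongr; exact hf i)
    _ = m * s.sum fun _ e ↦ e := by rw [← Finset.mul_sum, Finsupp.sum]
    _ ≤ m * P.totalDegree := by gcongr; exact le_totalDegree hs

/-- If `P` is a bivariate polynomial of total degree at most `d` and `p` is a
univariate polynomial of degree at most `m` (with `m ≥ 1`), then
`p'(v) · P(p(u), p(v))` has total degree at most `m·d + (m − 1)`. -/
theorem totalDegree_pullback_component_le (d m : ℕ) (hm : 1 ≤ m)
    (P : MvPolynomial (Fin 2) ℝ) (hP : P.totalDegree ≤ d)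
    (p : Polynomial ℝ) (hp : p.natDegree ≤ m) :
    ((Polynomial.aeval (MvPolynomial.X 1 : MvPolynomial (Fin 2) ℝ) p.derivative) *
        (MvPolynomial.bind₁
          (fun i : Fin 2 => Polynomial.aeval (MvPolynomial.X i : MvPolynomial (Fin 2) ℝ) p)
          P)).totalDegree ≤ m * d + (m - 1) := by
  rw [add_comm]
  refine (totalDegree_mul _ _).trans (add_le_add ?_ ?_)
  · exact (totalDegree_polynomialAeval_X_le 1 _).trans
      ((Polynomial.natDegree_derivative_le p).trans (Nat.sub_le_sub_right hp 1))
  · exact (totalDegree_bind₁_le _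
      (fun i ↦ (totalDegree_polynomialAeval_X_le i p).trans hp) P).trans (Nat.mul_le_mul_left m hP)
end

section
/- Let P, Q ∈ MvPolynomial (Fin 2) ℝ with d := max(totalDegree P, totalDegree Q) ≥ 1, and let p be a univariate real polynomial with p.natDegree = m where m ≥ 2. Form the separable pullback components Y₁ = p'(v)·P(p(u), p(v)) and Y₂ = p'(u)·Q(p(u), p(v)). Then max(totalDegree Y₁, totalDegree Y₂) = m·d + (m − 1); equivalently, max(totalDegree Y₁, totalDegree Y₂) + 1 = m·(d + 1). -/
open MvPolynomial

open scoped MonomialOrder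

/-- A finite sum with a term of strictly dominating degree has the degree and the leading
coefficient of that term. -/
theorem MonomialOrder.degree_sum_of_lt {σ R α : Type*} [CommSemiring R] (mo : MonomialOrder σ)
    {s : Finset α} {f : α → MvPolynomial σ R} {a : α} (ha : a ∈ s)
    (h : ∀ x ∈ s, x ≠ a → mo.degree (f x) ≺[mo] mo.degree (f a)) :
    mo.degree (∑ x ∈ s, f x) = mo.degree (f a) ∧
      mo.leadingCoeff (∑ x ∈ s, f x) = mo.leadingCoeff (f a) := by
  classical
  rw [← Finset.add_sum_erase s f ha]
  rcases (s.erase a).eq_empty_or_nonempty with he | ⟨b, hb⟩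
  · simp [he]
  · have hlt : mo.degree (∑ x ∈ s.erase a, f x) ≺[mo] mo.degree (f a) := by
      refine mo.degree_sum_le.trans_lt ((Finset.sup_lt_iff ?_).2 fun x hx => ?_)
      · exact bot_le.trans_lt (h b (Finset.mem_of_mem_erase hb) (Finset.ne_of_mem_erase hb))
      · exact h x (Finset.mem_of_mem_erase hx) (Finset.ne_of_mem_erase hx)
    exact ⟨mo.degree_add_of_lt hlt, mo.leadingCoeff_add_of_lt hlt⟩

theorem MonomialOrder.degree_aeval_X {σ R : Type*} [CommSemiring R]
    (mo : MonomialOrder σ) (i : σ) {p : Polynomial R} (hp : p ≠ 0) :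
    mo.degree (Polynomial.aeval (X i : MvPolynomial σ R) p) = Finsupp.single i p.natDegree ∧
      mo.leadingCoeff (Polynomial.aeval (X i : MvPolynomial σ R) p) = p.leadingCoeff := by
  classical
  have hsum : Polynomial.aeval (X i : MvPolynomial σ R) p =
      ∑ n ∈ p.support, monomial (Finsupp.single i n) (p.coeff n) := by
    rw [Polynomial.aeval_def, Polynomial.eval₂_eq_sum, Polynomial.sum_def]
    refine Finset.sum_congr rfl fun n _ => ?_
    rw [← C_mul_X_pow_eq_monomial, algebraMap_eq]
  have hlead : p.coeff p.natDegree ≠ 0 := Polynomial.leadingCoeff_ne_zero.2 hp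
  obtain ⟨h₁, h₂⟩ := mo.degree_sum_of_lt
    (f := fun n => monomial (Finsupp.single i n) (p.coeff n))
    (Polynomial.natDegree_mem_support_of_nonzero hp) (by
      intro n hn hne
      have hlt : n < p.natDegree := lt_of_le_of_ne (Polynomial.le_natDegree_of_mem_supp n hn) hne
      rw [mo.degree_monomial, mo.degree_monomial, if_neg (Polynomial.mem_support_iff.1 hn),
        if_neg hlead]
      refine mo.toSyn_strictMono (lt_of_le_of_ne (Finsupp.single_mono hlt.le) ?_)
      exact fun h => hne (Finsupp.single_injective i h))
  rw [hsum, h₁, h₂, mo.degree_monomial, if_neg hlead, mo.leadingCoeff_monomial]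
  exact ⟨rfl, rfl⟩

theorem MonomialOrder.aeval_X_ne_zero {σ R : Type*} [CommSemiring R]
    (mo : MonomialOrder σ) (i : σ) {p : Polynomial R} (hp : p ≠ 0) :
    Polynomial.aeval (X i : MvPolynomial σ R) p ≠ 0 := by
  rw [← mo.leadingCoeff_ne_zero_iff, (mo.degree_aeval_X i hp).2]
  exact Polynomial.leadingCoeff_ne_zero.2 hp

/-- Substituting polynomials `f i` of degree `n` in the single variable `i`, `n ≠ 0`, multiplies
monomial degrees by `n`. -/
theorem MonomialOrder.degree_bind₁_of_degree_eq_single {σ R : Type*} [CommRing R] [IsDomain R]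
    (mo : MonomialOrder σ) {n : ℕ} (hn : n ≠ 0) {f : σ → MvPolynomial σ R}
    (hf : ∀ i, f i ≠ 0) (hdeg : ∀ i, mo.degree (f i) = Finsupp.single i n)
    {P : MvPolynomial σ R} (hP : P ≠ 0) :
    mo.degree (bind₁ f P) = n • mo.degree P ∧ bind₁ f P ≠ 0 := by
  classical
  have hne (t : σ →₀ ℕ) {c : R} (hc : c ≠ 0) : bind₁ f (monomial t c) ≠ 0 := by
    rw [bind₁_monomial]
    exact mul_ne_zero (C_ne_zero.2 hc) (Finset.prod_ne_zero_iff.2 fun i _ => pow_ne_zero _ (hf i))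
  have hmon (t : σ →₀ ℕ) {c : R} (hc : c ≠ 0) :
      mo.degree (bind₁ f (monomial t c)) = n • t := by
    have h := hne t hc
    rw [bind₁_monomial] at h ⊢
    rw [mo.degree_mul' h, mo.degree_C, zero_add, mo.degree_prod fun i _ => pow_ne_zero _ (hf i)]
    simp only [mo.degree_pow, hdeg]
    conv_rhs => rw [← t.sum_single, Finsupp.sum, Finset.smul_sum]
    refine Finset.sum_congr rfl fun i _ => ?_
    simp [mul_comm]
  obtain ⟨h₁, h₂⟩ := mo.degree_sum_of_lt
    (f := fun t => bind₁ f (monomial t (P.coeff t))) (mo.degree_mem_support hP) (by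
      intro t ht hne'
      rw [hmon t (mem_support_iff.1 ht), hmon _ (mem_support_iff.1 (mo.degree_mem_support hP)),
        map_nsmul, map_nsmul]
      refine nsmul_lt_nsmul_right hn (lt_of_le_of_ne (mo.le_degree ht) ?_)
      exact fun h => hne' (mo.toSyn.injective h))
  have hsum : ∑ t ∈ P.support, bind₁ f (monomial t (P.coeff t)) = bind₁ f P := by
    rw [← map_sum, ← P.as_sum]
  rw [hsum] at h₁ h₂
  have hc := mem_support_iff.1 (mo.degree_mem_support hP)
  rw [h₁, hmon _ hc, ← mo.leadingCoeff_ne_zero_iff, h₂, mo.leadingCoeff_ne_zero_iff]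
  exact ⟨rfl, hne _ hc⟩

theorem MvPolynomial.totalDegree_aeval_X {σ R : Type*} [CommSemiring R] [LinearOrder σ]
    [WellFoundedGT σ] (i : σ) (p : Polynomial R) :
    (Polynomial.aeval (X i : MvPolynomial σ R) p).totalDegree = p.natDegree := by
  by_cases hp : p = 0
  · simp [hp]
  · rw [← degree_degLexDegree, (MonomialOrder.degLex.degree_aeval_X i hp).1, Finsupp.degree_single]

theorem MvPolynomial.totalDegree_derivative_mul_bind₁ {σ R : Type*} [CommRing R] [IsDomain R]
    [CharZero R] [LinearOrder σ] [WellFoundedGT σ] {p : Polynomial R} (hp : p.natDegree ≠ 0)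
    (j : σ) {P : MvPolynomial σ R} (hP : P ≠ 0) :
    (Polynomial.aeval (X j : MvPolynomial σ R) p.derivative *
        bind₁ (fun i => Polynomial.aeval (X i : MvPolynomial σ R) p) P).totalDegree =
      p.natDegree * P.totalDegree + (p.natDegree - 1) := by
  have hp₀ : p ≠ 0 := by
    rintro rfl
    simp at hp
  have hp' : p.derivative ≠ 0 := fun h => hp (Polynomial.derivative_eq_zero.1 h)
  obtain ⟨h₁, h₂⟩ := MonomialOrder.degLex.degree_bind₁_of_degree_eq_single hp
    (MonomialOrder.degLex.aeval_X_ne_zero · hp₀)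
    (fun i => (MonomialOrder.degLex.degree_aeval_X i hp₀).1) hP
  rw [totalDegree_mul_of_isDomain (MonomialOrder.degLex.aeval_X_ne_zero j hp') h₂,
    totalDegree_aeval_X, Polynomial.natDegree_derivative, ← degree_degLexDegree, h₁, map_nsmul,
    degree_degLexDegree, smul_eq_mul, add_comm]

/-- Exact degree growth for the separable pullback: if
`d = max(deg P, deg Q) ≥ 1` and `deg p = m ≥ 2`, then the pullback components
`Y₁ = p'(v)·P(p(u),p(v))` and `Y₂ = p'(u)·Q(p(u),p(v))` satisfy
`max(deg Y₁, deg Y₂) = m·d + (m − 1)`. -/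
theorem totalDegree_pullback_eq (d m : ℕ) (hm : 2 ≤ m)
    (P Q : MvPolynomial (Fin 2) ℝ)
    (hd : d = max P.totalDegree Q.totalDegree) (hd1 : 1 ≤ d)
    (p : Polynomial ℝ) (hp : p.natDegree = m) :
    max
      ((Polynomial.aeval (MvPolynomial.X 1 : MvPolynomial (Fin 2) ℝ) p.derivative) *
        (MvPolynomial.bind₁
          (fun i : Fin 2 => Polynomial.aeval (MvPolynomial.X i : MvPolynomial (Fin 2) ℝ) p)
          P)).totalDegree
      ((Polynomial.aeval (MvPolynomial.X 0 : MvPolynomial (Fin 2) ℝ) p.derivative) *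
        (MvPolynomial.bind₁
          (fun i : Fin 2 => Polynomial.aeval (MvPolynomial.X i : MvPolynomial (Fin 2) ℝ) p)
          Q)).totalDegree
      = m * d + (m - 1) := by
  subst hp
  have hm₀ : p.natDegree ≠ 0 := by omega
  by_cases hP : P = 0
  · have hQ : Q ≠ 0 := by
      rintro rfl
      simp [hP] at hd
      omega
    rw [totalDegree_derivative_mul_bind₁ hm₀ 0 hQ]
    simp [hP, hd]
  by_cases hQ : Q = 0
  · rw [totalDegree_derivative_mul_bind₁ hm₀ 1 hP]
    simp [hQ, hd]
  rw [totalDegree_derivative_mul_bind₁ hm₀ 1 hP, totalDegree_derivative_mul_bind₁ hm₀ 0 hQ, hd,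
    mul_max, max_add_add_right]
end

section
/- Let P ∈ MvPolynomial (Fin 2) ℝ be a nonzero bivariate real polynomial and let p be a univariate real polynomial with p.natDegree = m where m ≥ 1. Then the bivariate polynomial P(p(u), p(v)), obtained from P by substituting p applied to the first variable for the first variable and p applied to the second variable for the second variable, has total degree exactly m · totalDegree P. -/
open MvPolynomial

namespace MonomialOrder

variable {σ R : Type*} [CommRing R] (M : MonomialOrder σ)

/-- If one summand has strictly larger degree than all the others, it determines the degree of
the sum. -/
theorem degree_sum_of_forall_lt {α : Type*} {s : Finset α} {f : α → MvPolynomial σ R} {a : α}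
    (ha : a ∈ s) (h : ∀ b ∈ s, b ≠ a → M.toSyn (M.degree (f b)) < M.toSyn (M.degree (f a))) :
    M.degree (∑ b ∈ s, f b) = M.degree (f a) := by
  classical
  rw [← Finset.add_sum_erase s f ha]
  rcases (s.erase a).eq_empty_or_nonempty with he | ⟨c, hc⟩
  · simp [he]
  · apply M.degree_add_of_lt
    refine M.degree_sum_le.trans_lt ?_
    have hc' := h c (Finset.mem_of_mem_erase hc) (Finset.ne_of_mem_erase hc)
    rw [Finset.sup_lt_iff (bot_le.trans_lt hc')]
    exact fun b hb => h b (Finset.mem_of_mem_erase hb) (Finset.ne_of_mem_erase hb)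

theorem degree_aeval_X_s11 {p : Polynomial R} (hp : p ≠ 0) (i : σ) :
    M.degree (Polynomial.aeval (X i : MvPolynomial σ R) p) = Finsupp.single i p.natDegree := by
  classical
  have hdeg : ∀ k ∈ p.support,
      M.degree (monomial (Finsupp.single i k) (p.coeff k)) = Finsupp.single i k := by
    intro k hk
    rw [M.degree_monomial, if_neg (Polynomial.mem_support_iff.mp hk)]
  have hmem := Polynomial.natDegree_mem_support_of_nonzero hp
  have hsum : Polynomial.aeval (X i : MvPolynomial σ R) p =
      ∑ k ∈ p.support, monomial (Finsupp.single i k) (p.coeff k) := by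
    rw [Polynomial.aeval_eq_sum_range' (Nat.lt_succ_self _),
      ← Finset.sum_subset Polynomial.supp_subset_range_natDegree_succ]
    · refine Finset.sum_congr rfl fun k _ => ?_
      rw [X_pow_eq_monomial, smul_monomial, smul_eq_mul, mul_one]
    · intro k _ hk
      rw [Polynomial.notMem_support_iff.mp hk, zero_smul]
  rw [hsum, M.degree_sum_of_forall_lt hmem, hdeg _ hmem]
  intro k hk hne
  rw [hdeg k hk, hdeg _ hmem]
  refine M.toSyn_strictMono (lt_of_le_of_ne ?_ ?_)
  · exact Finsupp.single_mono (Polynomial.le_natDegree_of_mem_supp k hk)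
  · exact fun h => hne (Finsupp.single_injective i h)

/-- Substituting a nonconstant univariate polynomial into each variable multiplies the degree
of a multivariate polynomial by the degree of the univariate one. -/
theorem degree_bind₁_aeval_X [IsDomain R] {p : Polynomial R} (hp : p.natDegree ≠ 0)
    (P : MvPolynomial σ R) :
    M.degree (bind₁ (fun i => Polynomial.aeval (X i : MvPolynomial σ R) p) P) =
      p.natDegree • M.degree P := by
  classical
  rcases eq_or_ne P 0 with rfl | hP
  · simp
  have hp0 : p ≠ 0 := by
    rintro rfl
    simp at hp
  have hX : ∀ i : σ, Polynomial.aeval (X i : MvPolynomial σ R) p ≠ 0 := by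
    intro i
    apply M.ne_zero_of_degree_ne_zero
    rw [M.degree_aeval_X_s11 hp0]
    simpa using hp
  have hdeg : ∀ d ∈ P.support, M.degree (C (P.coeff d) *
      ∏ i ∈ d.support, Polynomial.aeval (X i : MvPolynomial σ R) p ^ d i) =
      p.natDegree • d := by
    intro d hd
    rw [M.degree_mul (by simpa using hd)
      (Finset.prod_ne_zero_iff.mpr fun i _ => pow_ne_zero _ (hX i)),
      M.degree_C, zero_add, M.degree_prod fun i _ => pow_ne_zero _ (hX i)]
    conv_rhs => rw [← Finsupp.sum_single d, Finsupp.sum, Finset.smul_sum]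
    refine Finset.sum_congr rfl fun i _ => ?_
    rw [M.degree_pow, M.degree_aeval_X_s11 hp0, Finsupp.smul_single, Finsupp.smul_single,
      smul_eq_mul, smul_eq_mul, mul_comm]
  have hmem := M.degree_mem_support hP
  have hsum : bind₁ (fun i => Polynomial.aeval (X i : MvPolynomial σ R) p) P =
      ∑ d ∈ P.support, C (P.coeff d) *
        ∏ i ∈ d.support, Polynomial.aeval (X i : MvPolynomial σ R) p ^ d i := by
    rw [bind₁, aeval_def, eval₂_eq]
    rfl
  rw [hsum, M.degree_sum_of_forall_lt hmem, hdeg _ hmem]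
  intro d hd hne
  rw [hdeg d hd, hdeg _ hmem, map_nsmul, map_nsmul]
  exact nsmul_lt_nsmul_right hp
    (lt_of_le_of_ne (M.le_degree hd) fun h => hne (M.toSyn.injective h))

end MonomialOrder

/-- If `P` is a nonzero bivariate real polynomial and `p` a univariate polynomial of
degree `m ≥ 1`, then `P(p(u), p(v))` has total degree exactly `m · totalDegree P`. -/
theorem totalDegree_separable_subst (m : ℕ) (hm : 1 ≤ m)
    (P : MvPolynomial (Fin 2) ℝ) (hP : P ≠ 0)
    (p : Polynomial ℝ) (hp : p.natDegree = m) :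
    (MvPolynomial.bind₁
        (fun i : Fin 2 => Polynomial.aeval (MvPolynomial.X i : MvPolynomial (Fin 2) ℝ) p)
        P).totalDegree = m * P.totalDegree := by
  rw [← degree_degLexDegree, ← degree_degLexDegree,
    MonomialOrder.degree_bind₁_aeval_X _ (by omega), hp, map_nsmul, smul_eq_mul]
end

section
/- Let ρ be a real number and let x, y : ℝ → ℝ. Suppose at a time t we have HasDerivAt x (y t − x t · ((x t)² + (y t)² − ρ²)) t and HasDerivAt y (−x t − y t · ((x t)² + (y t)² − ρ²)) t, and suppose (x t, y t) ≠ (0, 0). Then the radial function r := fun s => Real.sqrt ((x s)² + (y s)²) satisfies HasDerivAt r (r t · (ρ² − (r t)²)) t. -/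
/-- Along a solution of the cubic system `X_ρ` (away from the origin), the radial
function `r = √(x² + y²)` satisfies `ṙ = r(ρ² − r²)`. -/
theorem radial_derivative_cubic (ρ : ℝ) (x y : ℝ → ℝ) (t : ℝ)
    (hx : HasDerivAt x (y t - x t * ((x t) ^ 2 + (y t) ^ 2 - ρ ^ 2)) t)
    (hy : HasDerivAt y (-x t - y t * ((x t) ^ 2 + (y t) ^ 2 - ρ ^ 2)) t)
    (hne : (x t, y t) ≠ (0, 0)) :
    HasDerivAt (fun s => Real.sqrt ((x s) ^ 2 + (y s) ^ 2))
      (Real.sqrt ((x t) ^ 2 + (y t) ^ 2) *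
        (ρ ^ 2 - (Real.sqrt ((x t) ^ 2 + (y t) ^ 2)) ^ 2)) t := by
  have hpos : 0 < x t ^ 2 + y t ^ 2 := by
    refine lt_of_le_of_ne (by positivity) fun h => hne ?_
    have hx0 : x t = 0 := by nlinarith [sq_nonneg (x t), sq_nonneg (y t)]
    have hy0 : y t = 0 := by nlinarith [sq_nonneg (x t), sq_nonneg (y t)]
    rw [hx0, hy0]
  have hr : Real.sqrt (x t ^ 2 + y t ^ 2) ≠ 0 := (Real.sqrt_pos.mpr hpos).ne'
  have hsq := Real.sq_sqrt hpos.le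
  convert ((hx.fun_pow 2).fun_add (hy.fun_pow 2)).sqrt hpos.ne' using 1
  rw [eq_div_iff (mul_ne_zero two_ne_zero hr), hsq]
  push_cast
  linear_combination 2 * (ρ ^ 2 - (x t ^ 2 + y t ^ 2)) * hsq
end

section
/- Let ρ > 0 be a real number and define γ : ℝ → ℝ × ℝ by γ(t) = (ρ·cos t, −ρ·sin t). Then: (i) for every real t, HasDerivAt (fun s => ρ·cos s) (P_ρ(γ t)) t and HasDerivAt (fun s => −ρ·sin s) (Q_ρ(γ t)) t, i.e. γ is a solution of the cubic system X_ρ; (ii) γ(t + 2π) = γ(t) for all t; and (iii) the range of γ equals the circle {(a, b) : a² + b² = ρ²}. -/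
open Real

/-- The circle curve `γ(t) = (ρ cos t, −ρ sin t)` is a `2π`-periodic solution of the
cubic system `X_ρ`, and its range is the circle of radius `ρ`. -/
theorem circle_periodic_solution (ρ : ℝ) (hρ : 0 < ρ)
    (γ : ℝ → ℝ × ℝ) (hγ : γ = fun t => (ρ * Real.cos t, -ρ * Real.sin t)) :
    (∀ t : ℝ,
      HasDerivAt (fun s => ρ * Real.cos s)
        ((γ t).2 - (γ t).1 * ((γ t).1 ^ 2 + (γ t).2 ^ 2 - ρ ^ 2)) t ∧
      HasDerivAt (fun s => -ρ * Real.sin s)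
        (-(γ t).1 - (γ t).2 * ((γ t).1 ^ 2 + (γ t).2 ^ 2 - ρ ^ 2)) t) ∧
    (∀ t : ℝ, γ (t + 2 * π) = γ t) ∧
    Set.range γ = {q : ℝ × ℝ | q.1 ^ 2 + q.2 ^ 2 = ρ ^ 2} := by
  subst hγ
  have radius (t : ℝ) : (ρ * cos t) ^ 2 + (-ρ * sin t) ^ 2 = ρ ^ 2 := by
    linear_combination ρ ^ 2 * sin_sq_add_cos_sq t
  refine ⟨fun t => ⟨?_, ?_⟩, fun t => by simp, ?_⟩
  · simp only [radius t, sub_self, mul_zero, sub_zero]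
    simpa using (hasDerivAt_cos t).const_mul ρ
  · simp only [radius t, sub_self, mul_zero, sub_zero]
    simpa using (hasDerivAt_sin t).const_mul (-ρ)
  · ext ⟨a, b⟩
    constructor
    · rintro ⟨t, ht⟩
      rw [← ht]
      exact radius t
    · intro (h : a ^ 2 + b ^ 2 = ρ ^ 2)
      have norm_eq : ‖(⟨a, -b⟩ : ℂ)‖ = ρ := by
        rw [← sq_eq_sq₀ (norm_nonneg _) hρ.le, Complex.sq_norm, Complex.normSq_mk]
        linear_combination h
      have hcos := Complex.norm_mul_cos_arg ⟨a, -b⟩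
      have hsin := Complex.norm_mul_sin_arg ⟨a, -b⟩
      rw [norm_eq] at hcos hsin
      exact ⟨Complex.arg ⟨a, -b⟩, Prod.ext hcos (by linear_combination -hsin)⟩
end
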